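/- Let F be a finite field, σ a finite type indexing variables, I a finite index set, and D a natural number with Fintype.card F > D. Let (P_i)_{i ∈ I} be a family of nonzero multivariate polynomials in MvPolynomial σ F such that for every variable x ∈ σ and every i ∈ I the degree of P_i in x is at most 1, and such that every variable x ∈ σ occurs (i.e., has positive degree) in at most D of the polynomials P_i. Then there exists an assignment a : σ → F such that P_i evaluated at a is nonzero for every i ∈ I. -/

import Mathlib

/-- Algebraic core of the MDS-property proof (Theorem 2): over a finite field `F` with
more than `D` elements, given a finite family of nonzero multivariate polynomials, each
of degree at most 1 in every variable, such that every variable occurs (has positive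
degree) in at most `D` of the polynomials, there is a common nonvanishing assignment. -/
theorem common_nonvanishing_assignment (F : Type*) [Field F] [Fintype F]
    (σ : Type*) [Fintype σ] (I : Type*) [Fintype I] (D : ℕ)
    (hD : D < Fintype.card F)
    (P : I → MvPolynomial σ F) (hP0 : ∀ i, P i ≠ 0)
    (hdeg : ∀ (x : σ) (i : I), (P i).degreeOf x ≤ 1)
    (hocc : ∀ x : σ,
      (Finset.univ.filter (fun i : I => 0 < (P i).degreeOf x)).card ≤ D) :
    ∃ a : σ → F, ∀ i : I, MvPolynomial.eval a (P i) ≠ 0 := by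
  by_contra hcon
  push Not at hcon
  have hne : (∏ i, P i) ≠ 0 := Finset.prod_ne_zero_iff.mpr (fun i _ => hP0 i)
  apply hne
  apply MvPolynomial.eq_zero_of_eval_zero_at_prod_finset _ (fun _ => Finset.univ)
  · intro x
    rw [Finset.card_univ]
    refine lt_of_le_of_lt ?_ hD
    refine (MvPolynomial.degreeOf_prod_le x Finset.univ P).trans (le_trans ?_ (hocc x))
    rw [Finset.card_filter]
    refine Finset.sum_le_sum (fun i _ => ?_)
    have := hdeg x i
    split_ifs <;> omega
  · intro a _
    obtain ⟨i, hi⟩ := hcon a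
    rw [map_prod]
    exact Finset.prod_eq_zero (Finset.mem_univ i) hi
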